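/- arXiv:1009.5360 — 6 statements merged into one kernel-verified Lean document; each statement's English description precedes it below -/
import Mathlib

section
/- For every integer h ≥ 2 and every integer n ≥ 2, one has (1/2)·s_F(n)/(log n) ≤ s_F(n^h) ≤ 2h·(log n)·s_F(n); equivalently, c₄/log n ≤ s_F(n^h)/s_F(n) ≤ c₃·log n with c₃ = 2h and c₄ = 1/2. -/
/-- Zeckendorf sum of digits: number of summands in the Zeckendorf
representation of `n` (equivalently, minimal number of Fibonacci numbers
needed to write `n` as a sum of Fibonacci numbers). -/
def sF (n : ℕ) : ℕ := (Nat.zeckendorf n).length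

/-- Lucas numbers: `L 0 = 2`, `L k = F (k-1) + F (k+1)` for `k ≥ 1`. -/
def lucas : ℕ → ℕ
  | 0 => 2
  | k + 1 => Nat.fib k + Nat.fib (k + 2)

theorem sF_pos {n : ℕ} (hn : 0 < n) : 0 < sF n := by
  simp [sF, Nat.zeckendorf_of_pos hn]

theorem two_pow_sF_le {n : ℕ} (hn : 2 ≤ n) : 2 ^ sF n ≤ n := by
  induction n using Nat.strong_induction_on with
  | _ n ih =>
    have hle := Nat.fib_greatestFib_le n
    have hpos : 0 < Nat.fib (Nat.greatestFib n) := by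
      simp only [Nat.fib_pos, Nat.greatestFib_pos]; omega
    have hs : sF n = sF (n - Nat.fib (Nat.greatestFib n)) + 1 := by
      simp [sF, Nat.zeckendorf_of_pos (show 0 < n by omega)]
    have hlt : n - Nat.fib (Nat.greatestFib n) < Nat.fib (Nat.greatestFib n) := by
      rw [← Nat.greatestFib_lt]
      have h1 := Nat.greatestFib_sub_fib_greatestFib_le_greatestFib (n := n) (by omega)
      have h2 : 0 < Nat.greatestFib n := by simp only [Nat.greatestFib_pos]; omega
      omega
    set r := n - Nat.fib (Nat.greatestFib n) with hr
    rw [hs, pow_succ]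
    obtain h0 | h1 | h2 : r = 0 ∨ r = 1 ∨ 2 ≤ r := by omega
    · simpa [h0, sF] using hn
    · have hs1 : sF 1 = 1 := by simp [sF, show Nat.greatestFib 1 = 2 by decide]
      have h4 : 4 ≤ n := by
        by_contra! hn4
        have h3 : n = 3 := by omega
        have hg : 4 ≤ Nat.greatestFib n := by
          rw [Nat.le_greatestFib, h3]; decide
        have := Nat.fib_mono hg
        have hf : Nat.fib 4 = 3 := by decide
        omega
      rw [h1, hs1]
      omega
    · have := ih r (by omega) h2
      omega

theorem sF_le_two_mul_log {n : ℕ} (hn : 2 ≤ n) : (sF n : ℝ) ≤ 2 * Real.log n := by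
  have h : ((2 : ℝ) ^ sF n) ≤ n := by exact_mod_cast two_pow_sF_le hn
  have hlog := Real.log_le_log (by positivity) h
  rw [Real.log_pow] at hlog
  nlinarith [Real.log_two_gt_d9, (sF n).cast_nonneg (α := ℝ)]

theorem stmt_0 (h : ℕ) (hh : 2 ≤ h) (n : ℕ) (hn : 2 ≤ n) :
    (1 / 2 : ℝ) * (sF n) / Real.log n ≤ (sF (n ^ h) : ℝ) ∧
      (sF (n ^ h) : ℝ) ≤ 2 * h * Real.log n * (sF n) := by
  have hlog : 0 < Real.log n := Real.log_pos (by exact_mod_cast hn)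
  have one_le_sF {m : ℕ} (hm : 0 < m) : (1 : ℝ) ≤ sF m := by exact_mod_cast sF_pos hm
  constructor
  · calc (1 / 2 : ℝ) * sF n / Real.log n ≤ 1 := by
          rw [div_le_one hlog]
          linarith [sF_le_two_mul_log hn]
      _ ≤ sF (n ^ h) := one_le_sF (by positivity)
  · calc (sF (n ^ h) : ℝ) ≤ 2 * Real.log ((n ^ h : ℕ) : ℝ) :=
          sF_le_two_mul_log (hn.trans (Nat.le_self_pow (by omega) n))
      _ = 2 * h * Real.log n := by
          rw [Nat.cast_pow, Real.log_pow]
          ring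
      _ ≤ 2 * h * Real.log n * sF n :=
          le_mul_of_one_le_right (by positivity) (one_le_sF (show 0 < n by omega))
end

section
/- For every integer h ≥ 2 there are infinitely many positive integers n such that s_F(n^h)/s_F(n) > log n; i.e., the upper bound c₃·log n for s_F(n^h)/s_F(n) is attained in order of magnitude with constant c₃' = 1. -/
open Real goldenRatio

theorem sF_fib_add {a r : ℕ} (ha : 2 ≤ a) (hr : r < Nat.fib (a - 1)) :
    sF (Nat.fib a + r) = sF r + 1 := by
  have hfib : Nat.fib (a + 1) = Nat.fib (a - 1) + Nat.fib a := Nat.fib_add_one (by omega)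
  have hpos : 0 < Nat.fib a := Nat.fib_pos.2 (by omega)
  have hgreatest : Nat.greatestFib (Nat.fib a + r) = a := by
    apply le_antisymm
    · exact Nat.lt_succ_iff.1 (Nat.greatestFib_lt.2 (by rw [Nat.succ_eq_add_one]; omega))
    · exact Nat.le_greatestFib.2 (by omega)
  rw [sF, Nat.zeckendorf_of_pos (by omega), hgreatest, Nat.add_sub_cancel_left, List.length_cons,
    sF]

theorem le_sF_fib_sub {m M : ℕ} (hm : 1 ≤ m) (hM : 0 < M) (hMm : M ≤ Nat.fib m) (t : ℕ) :
    t ≤ sF (Nat.fib (m + 2 * t) - M) := by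
  induction t with
  | zero => exact Nat.zero_le _
  | succ t ih =>
    have hrec : Nat.fib (m + 2 * (t + 1)) = Nat.fib (m + 2 * t) + Nat.fib (m + 2 * t + 1) :=
      Nat.fib_add_two
    have hmono : Nat.fib m ≤ Nat.fib (m + 2 * t) := Nat.fib_mono (by omega)
    have hsplit : Nat.fib (m + 2 * (t + 1)) - M =
        Nat.fib (m + 2 * t + 1) + (Nat.fib (m + 2 * t) - M) := by omega
    rw [hsplit, sF_fib_add (by omega) (by rw [Nat.add_sub_cancel]; omega)]
    omega

theorem lt_sF_fib_add_fib_sub {m M : ℕ} (hm : 1 ≤ m) (hM : 0 < M) (hMm : M ≤ Nat.fib m) (t : ℕ) :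
    t < sF (Nat.fib (m + 2 * t) + Nat.fib (m + 2 * t + 2) - M) := by
  have hmono : Nat.fib m ≤ Nat.fib (m + 2 * t) := Nat.fib_mono (by omega)
  have hle : Nat.fib (m + 2 * t) ≤ Nat.fib (m + 2 * t + 1) := Nat.fib_le_fib_succ
  have hsplit : Nat.fib (m + 2 * t) + Nat.fib (m + 2 * t + 2) - M =
      Nat.fib (m + 2 * t + 2) + (Nat.fib (m + 2 * t) - M) := by omega
  rw [hsplit, sF_fib_add (by omega)
    (by rw [show m + 2 * t + 2 - 1 = m + 2 * t + 1 from rfl]; omega)]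
  have := le_sF_fib_sub hm hM hMm t
  omega

theorem sF_lucas {k : ℕ} (hk : 2 ≤ k) : sF (lucas (k + 1)) = 2 := by
  have hlt : Nat.fib k < Nat.fib (k + 1) := Nat.fib_lt_fib_succ hk
  have hpos : 0 < Nat.fib (k - 1) := Nat.fib_pos.2 (by omega)
  have h0 : sF 0 = 0 := by simp [sF]
  rw [lucas, add_comm, sF_fib_add (by omega) hlt, ← add_zero (Nat.fib k), sF_fib_add hk hpos, h0]

theorem coe_lucas (k : ℕ) : (lucas k : ℝ) = φ ^ k + ψ ^ k := by
  cases k with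
  | zero => norm_num [lucas]
  | succ k =>
    have h1 := fib_succ_sub_goldenRatio_mul_fib k
    have h2 := fib_succ_sub_goldenConj_mul_fib k
    have h3 := goldenRatio_mul_goldenConj
    have h4 := goldenRatio_add_goldenConj
    rw [pow_succ, pow_succ, ← h1, ← h2, lucas, Nat.fib_add_two]
    push_cast
    linear_combination (-(Nat.fib (k + 1) : ℝ)) * h4 + 2 * (Nat.fib k : ℝ) * h3

theorem goldenRatio_pow_le_fib_add_two (n : ℕ) : φ ^ n ≤ Nat.fib (n + 2) := by
  rw [← fib_succ_sub_goldenConj_mul_fib, Nat.fib_add_two]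
  push_cast
  nlinarith [neg_one_lt_goldenConj, (Nat.cast_nonneg (Nat.fib n) : (0 : ℝ) ≤ _)]

theorem two_mul_log_goldenRatio_lt_one : 2 * log φ < 1 := by
  have h : log (φ ^ 2) < 1 := by
    rw [log_lt_iff_lt_exp (by positivity)]
    have hsq := goldenRatio_sq
    have he := exp_one_gt_d9
    nlinarith [goldenRatio_pos]
  rw [log_pow] at h
  exact_mod_cast h

theorem pow_sub_sub_pow_le {x y : ℝ} (hy : 0 ≤ y) (hyx : y ≤ x) (n : ℕ) :
    x ^ (n + 1) - (x - y) ^ (n + 1) ≤ (n + 1) * y * x ^ n := by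
  induction n with
  | zero => simp
  | succ n ih =>
    have h1 := mul_le_mul_of_nonneg_left ih (sub_nonneg.2 hyx)
    have h2 : 0 ≤ (n + 1) * y * y * x ^ n := by have := hy.trans hyx; positivity
    push_cast
    linear_combination h1 + h2

theorem lucas_pow_lt_and_le (g j : ℕ) :
    lucas (2 * j + 1) ^ (g + 2) < lucas ((2 * j + 1) * (g + 2)) ∧
    lucas ((2 * j + 1) * (g + 2)) ≤
      lucas (2 * j + 1) ^ (g + 2) + Nat.fib ((2 * j + 1) * g + 2 * g + 7) := by
  obtain ⟨x, hx⟩ : ∃ x, x = φ ^ (2 * j + 1) := ⟨_, rfl⟩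
  obtain ⟨y, hy⟩ : ∃ y, y = -ψ ^ (2 * j + 1) := ⟨_, rfl⟩
  have hxy : x * y = 1 := by
    rw [hx, hy, mul_neg, ← mul_pow, goldenRatio_mul_goldenConj, Odd.neg_one_pow ⟨j, rfl⟩, neg_neg]
  have hx1 : 1 < x := hx ▸ one_lt_pow₀ one_lt_goldenRatio (by omega)
  have hy0 : 0 < y := pos_of_mul_pos_right (hxy ▸ one_pos) (by linarith)
  have hy1 : y < 1 := by nlinarith
  have hL : (lucas (2 * j + 1) : ℝ) = x - y := by rw [coe_lucas, hx, hy]; ring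
  have hLh : (lucas ((2 * j + 1) * (g + 2)) : ℝ) = x ^ (g + 2) + (-y) ^ (g + 2) := by
    rw [coe_lucas, pow_mul, pow_mul, hx, hy, neg_neg]
  have hypow : |(-y) ^ (g + 2)| < 1 := by
    rw [abs_pow, abs_neg, abs_of_pos hy0]
    exact pow_lt_one₀ hy0.le hy1 (by omega)
  obtain ⟨hlo, hhi⟩ := abs_lt.1 hypow
  have hxg : 1 ≤ x ^ g := one_le_pow₀ hx1.le
  have hxg1 : y * x ^ (g + 1) = x ^ g := by rw [pow_succ]; linear_combination x ^ g * hxy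
  constructor
  · have hpow : (x - y) ^ (g + 1) ≤ x ^ (g + 1) :=
      pow_le_pow_left₀ (by linarith) (by linarith) _
    have hmul := mul_le_mul_of_nonneg_left hpow (by linarith : 0 ≤ x - y)
    rw [← Nat.cast_lt (α := ℝ), Nat.cast_pow, hL, hLh]
    have e1 : (x - y) ^ (g + 2) = (x - y) * (x - y) ^ (g + 1) := pow_succ' _ _
    have e2 : x ^ (g + 2) = x * x ^ (g + 1) := pow_succ' _ _
    linarith [sub_mul x y (x ^ (g + 1))]
  · have hbern := pow_sub_sub_pow_le hy0.le (by linarith : y ≤ x) (g + 1)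
    push_cast at hbern
    rw [mul_assoc, hxg1] at hbern
    have hfib : (g + 3 : ℝ) * x ^ g ≤ Nat.fib ((2 * j + 1) * g + 2 * g + 7) := by
      refine le_trans ?_ (goldenRatio_pow_le_fib_add_two ((2 * j + 1) * g + 2 * g + 5))
      have hsq : (2 : ℝ) ≤ φ ^ 2 := by linarith [goldenRatio_sq, one_lt_goldenRatio]
      have htwo : ((g + 2 : ℕ) : ℝ) + 1 ≤ 2 ^ (g + 2) := by
        exact_mod_cast Nat.succ_le_of_lt (Nat.lt_two_pow_self (n := g + 2))
      have hφ : (g + 3 : ℝ) ≤ φ ^ (2 * g + 5) := calc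
        (g + 3 : ℝ) = ((g + 2 : ℕ) : ℝ) + 1 := by push_cast; ring
        _ ≤ 2 ^ (g + 2) := htwo
        _ ≤ (φ ^ 2) ^ (g + 2) := pow_le_pow_left₀ (by norm_num) hsq _
        _ = φ ^ (2 * g + 4) := by rw [← pow_mul]; ring_nf
        _ ≤ φ ^ (2 * g + 5) := pow_le_pow_right₀ one_lt_goldenRatio.le (by omega)
      rw [add_assoc ((2 * j + 1) * g), pow_add, pow_mul, ← hx, mul_comm]
      gcongr
    rw [← Nat.cast_le (α := ℝ), Nat.cast_add, Nat.cast_pow, hL, hLh]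
    linarith

theorem lt_sF_lucas_pow {g j : ℕ} (hj : g + 3 ≤ j) :
    2 * j < sF (lucas (2 * j + 1) ^ (g + 2)) + (g + 3) := by
  obtain ⟨hlt, hle⟩ := lucas_pow_lt_and_le g j
  obtain ⟨t, ht⟩ : ∃ t, t = 2 * j - (g + 3) := ⟨_, rfl⟩
  have hidx : (2 * j + 1) * (g + 2) = (2 * j + 1) * g + 2 * g + 7 + 2 * t + 1 := by
    rw [mul_add]; omega
  have key := lt_sF_fib_add_fib_sub (m := (2 * j + 1) * g + 2 * g + 7) (by omega)
    (Nat.sub_pos_of_lt hlt) (Nat.sub_le_iff_le_add'.2 hle) t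
  have hlucas : lucas ((2 * j + 1) * (g + 2)) = Nat.fib ((2 * j + 1) * g + 2 * g + 7 + 2 * t) +
      Nat.fib ((2 * j + 1) * g + 2 * g + 7 + 2 * t + 2) := by rw [hidx, lucas]
  rw [← hlucas, Nat.sub_sub_self hlt.le] at key
  omega

theorem lt_lucas_two_mul_add_one {j : ℕ} (hj : 1 ≤ j) : j < lucas (2 * j + 1) := by
  have h1 := Nat.le_fib_add_one (2 * j + 2)
  rw [lucas]
  omega

theorem log_lucas_two_mul_add_one_lt {j : ℕ} (hj : 1 ≤ j) :
    log (lucas (2 * j + 1)) < (2 * j + 1) * log φ := by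
  have hpos : (0 : ℝ) < lucas (2 * j + 1) := by
    exact_mod_cast (Nat.zero_le j).trans_lt (lt_lucas_two_mul_add_one hj)
  have hψ : ψ ^ (2 * j + 1) < 0 := Odd.pow_neg ⟨j, rfl⟩ goldenConj_neg
  have hlt := log_lt_log hpos (by rw [coe_lucas]; linarith : _ < φ ^ (2 * j + 1))
  rw [log_pow] at hlt
  exact_mod_cast hlt

theorem stmt_1 (h : ℕ) (hh : 2 ≤ h) (N : ℕ) :
    ∃ n : ℕ, N < n ∧ (sF (n ^ h) : ℝ) / (sF n) > Real.log n := by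
  obtain ⟨g, rfl⟩ := Nat.exists_eq_add_of_le' hh
  have hδ : 0 < 1 - 2 * log φ := sub_pos.2 two_mul_log_goldenRatio_lt_one
  obtain ⟨i, hi⟩ := exists_nat_gt ((g + 4) / (1 - 2 * log φ))
  rw [div_lt_iff₀ hδ] at hi
  obtain ⟨j, hj⟩ : ∃ j, j = N + i + g + 3 := ⟨_, rfl⟩
  refine ⟨lucas (2 * j + 1), ?_, ?_⟩
  · have := lt_lucas_two_mul_add_one (j := j) (by omega)
    omega
  · rw [sF_lucas (by omega), gt_iff_lt, Nat.cast_ofNat, lt_div_iff₀ two_pos]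
    have hsF : (2 * j : ℝ) < sF (lucas (2 * j + 1) ^ (g + 2)) + (g + 3) := by
      exact_mod_cast lt_sF_lucas_pow (g := g) (j := j) (by omega)
    have hlog := log_lucas_two_mul_add_one_lt (j := j) (by omega)
    have hij : (i : ℝ) ≤ 2 * j + 1 := by exact_mod_cast (by omega : i ≤ 2 * j + 1)
    have := mul_le_mul_of_nonneg_right hij hδ.le
    linarith
end

section
/- Let k ≥ 1 and let z be an integer with 0 < z ≤ F_{2k+1}. Let l ≥ 0 be such that F_{2l} < z ≤ F_{2l+1} (with F_0 = 0). Then s_F(F_{2k+1} − z) = (k − l) + s_F(F_{2l+1} − z), and consequently s_F(F_{2k+1} − z) ≥ k − (log z)/(2 log φ) − δ'/2, where δ' = (log √5)/(log φ) + 3/2. -/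
theorem greatestFib_eq_of_fib_le_of_lt {m n : ℕ} (h : Nat.fib n ≤ m) (h' : m < Nat.fib (n + 1)) :
    Nat.greatestFib m = n :=
  le_antisymm (Nat.lt_succ_iff.1 (Nat.greatestFib_lt.2 h')) (Nat.le_greatestFib.2 h)

theorem sF_fib_add_s6 {m n : ℕ} (hn : 0 < n) (h : Nat.fib n + m < Nat.fib (n + 1)) :
    sF (Nat.fib n + m) = sF m + 1 := by
  have hpos : 0 < Nat.fib n + m := Nat.add_pos_left (Nat.fib_pos.2 hn) m
  rw [sF, Nat.zeckendorf_of_pos hpos, greatestFib_eq_of_fib_le_of_lt (Nat.le_add_right _ _) h,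
    Nat.add_sub_cancel_left, List.length_cons, sF]

theorem sF_fib_odd_sub {z l : ℕ} (hz : 0 < z) (hl : z ≤ Nat.fib (2 * l + 1)) (d : ℕ) :
    sF (Nat.fib (2 * (l + d) + 1) - z) = d + sF (Nat.fib (2 * l + 1) - z) := by
  induction d with
  | zero => simp
  | succ d ih =>
    have hle : z ≤ Nat.fib (2 * (l + d) + 1) := hl.trans (Nat.fib_mono (by omega))
    have hrec : Nat.fib (2 * (l + (d + 1)) + 1) =
        Nat.fib (2 * (l + d) + 1) + Nat.fib (2 * (l + d) + 2) := Nat.fib_add_two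
    have hsplit : Nat.fib (2 * (l + (d + 1)) + 1) - z =
        Nat.fib (2 * (l + d) + 2) + (Nat.fib (2 * (l + d) + 1) - z) := by omega
    have hlt : Nat.fib (2 * (l + d) + 2) + (Nat.fib (2 * (l + d) + 1) - z) <
        Nat.fib (2 * (l + d) + 2 + 1) := by
      have : Nat.fib (2 * (l + d) + 2 + 1) =
        Nat.fib (2 * (l + d) + 1) + Nat.fib (2 * (l + d) + 2) := Nat.fib_add_two
      omega
    rw [hsplit, sF_fib_add_s6 (by omega) hlt, ih]
    omega

theorem goldenRatio_pow_even_le (l : ℕ) :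
    Real.goldenRatio ^ (2 * l) ≤ √5 * (Nat.fib (2 * l) + 1) := by
  have h5 : (1 : ℝ) ≤ √5 := Real.one_le_sqrt.2 (by norm_num)
  have hψ : Real.goldenConj ^ (2 * l) ≤ 1 := by
    rw [pow_mul]
    refine pow_le_one₀ (sq_nonneg _) ?_
    nlinarith [Real.goldenConj_sq, Real.goldenConj_neg]
  have hfib : √5 * Nat.fib (2 * l) = Real.goldenRatio ^ (2 * l) - Real.goldenConj ^ (2 * l) := by
    rw [Real.coe_fib_eq, mul_div_cancel₀ _ (by positivity)]
  linarith

theorem two_mul_log_goldenRatio_le {z l : ℕ} (hl : Nat.fib (2 * l) < z) :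
    2 * l * Real.log Real.goldenRatio ≤ Real.log (√5) + Real.log z := by
  have hz : (0 : ℝ) < z := by exact_mod_cast Nat.zero_lt_of_lt hl
  have hle : (Nat.fib (2 * l) + 1 : ℝ) ≤ z := by exact_mod_cast hl
  rw [← Real.log_mul (by positivity) hz.ne']
  have hlog := Real.log_le_log (pow_pos Real.goldenRatio_pos (2 * l))
    ((goldenRatio_pow_even_le l).trans (mul_le_mul_of_nonneg_left hle (Real.sqrt_nonneg 5)))
  rw [Real.log_pow] at hlog
  exact_mod_cast hlog

theorem stmt_6 (k : ℕ) (hk : 1 ≤ k) (z : ℕ) (hz : 0 < z) (hz' : z ≤ Nat.fib (2 * k + 1))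
    (l : ℕ) (hl : Nat.fib (2 * l) < z) (hl' : z ≤ Nat.fib (2 * l + 1)) :
    sF (Nat.fib (2 * k + 1) - z) = (k - l) + sF (Nat.fib (2 * l + 1) - z) ∧
      (sF (Nat.fib (2 * k + 1) - z) : ℝ) ≥
        k - Real.log z / (2 * Real.log ((1 + Real.sqrt 5) / 2)) -
          (Real.log (Real.sqrt 5) / Real.log ((1 + Real.sqrt 5) / 2) + 3 / 2) / 2 := by
  have hlk : l ≤ k := by
    by_contra! h
    have : Nat.fib (2 * k + 1) ≤ Nat.fib (2 * l) := Nat.fib_mono (by omega)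
    omega
  have hsum : sF (Nat.fib (2 * k + 1) - z) = (k - l) + sF (Nat.fib (2 * l + 1) - z) := by
    simpa [Nat.add_sub_cancel' hlk] using sF_fib_odd_sub hz hl' (k - l)
  refine ⟨hsum, ?_⟩
  rw [hsum, ← Real.goldenRatio]
  push_cast [Nat.cast_sub hlk]
  have hφ : 0 < Real.log Real.goldenRatio := Real.log_pos Real.one_lt_goldenRatio
  have hl_le : (l : ℝ) ≤ Real.log z / (2 * Real.log Real.goldenRatio) +
      Real.log (√5) / Real.log Real.goldenRatio / 2 := by
    rw [div_div, mul_comm (Real.log Real.goldenRatio) 2, ← add_div, le_div_iff₀ (by positivity)]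
    linarith [two_mul_log_goldenRatio_le hl]
  have hs : (0 : ℝ) ≤ sF (Nat.fib (2 * l + 1) - z) := Nat.cast_nonneg _
  linarith
end

section
/- For all integers h ≥ 2 and k ≥ 1, one has 0 < L_{h(2k−1)} − (L_{2k−1})^h ≤ 2^{h−1} · φ^{(h−2)(2k−1)}; that is, the h-th power of the odd-indexed Lucas number L_{2k−1} is strictly smaller than L_{h(2k−1)}, and the difference is at most 2^{h−1}·φ^{(h−2)(2k−1)}. -/
theorem lucas_add_two (n : ℕ) : lucas (n + 2) = lucas (n + 1) + lucas n := by
  cases n with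
  | zero => rfl
  | succ n =>
    have h1 := Nat.fib_add_two (n := n)
    have h2 := Nat.fib_add_two (n := n + 1)
    have h3 := Nat.fib_add_two (n := n + 2)
    simp only [lucas, add_assoc, Nat.reduceAdd] at *
    omega

theorem lucas_pos (n : ℕ) : 0 < lucas n := by
  cases n with
  | zero => simp [lucas]
  | succ n =>
    have := Nat.fib_pos.2 (Nat.succ_pos (n + 1))
    exact Nat.add_pos_right _ this

/-- Binet's formula for the Lucas numbers. -/
theorem coe_lucas_eq (n : ℕ) :
    (lucas n : ℝ) = Real.goldenRatio ^ n + Real.goldenConj ^ n := by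
  induction n using Nat.twoStepInduction with
  | zero => norm_num [lucas]
  | one => simp [lucas]
  | more n ih₀ ih₁ =>
    rw [lucas_add_two, Nat.cast_add, ih₀, ih₁, pow_add _ n 2, pow_add _ n 2,
      Real.goldenRatio_sq, Real.goldenConj_sq]
    ring

theorem pow_add_pow_pos_of_mul_eq_neg_one {x y : ℝ} (hxy : x * y = -1) (hs : 0 < x + y) (n : ℕ) :
    0 < x ^ n + y ^ n := by
  induction n using Nat.twoStepInduction with
  | zero => norm_num
  | one => simpa using hs
  | more n ih₀ ih₁ =>
    have key : x ^ (n + 2) + y ^ (n + 2) =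
        (x + y) * (x ^ (n + 1) + y ^ (n + 1)) + (x ^ n + y ^ n) := by
      linear_combination (-(x ^ n + y ^ n)) * hxy
    rw [key]
    positivity

theorem add_pow_lt_and_sub_le_of_mul_eq_neg_one {x y : ℝ} (hxy : x * y = -1) (hx : 1 ≤ x)
    (hs : 0 < x + y) (n : ℕ) :
    (x + y) ^ (n + 2) < x ^ (n + 2) + y ^ (n + 2) ∧
      x ^ (n + 2) + y ^ (n + 2) - (x + y) ^ (n + 2) ≤ 2 ^ (n + 1) * x ^ n := by
  have hy : y < 0 := by nlinarith
  induction n with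
  | zero => constructor <;> norm_num <;> linarith [add_sq x y]
  | succ n ih =>
    obtain ⟨hlt, hle⟩ := ih
    have key : x ^ (n + 1 + 2) + y ^ (n + 1 + 2) - (x + y) ^ (n + 1 + 2) =
        (x + y) * (x ^ (n + 2) + y ^ (n + 2) - (x + y) ^ (n + 2)) +
          (x ^ (n + 1) + y ^ (n + 1)) := by
      linear_combination (-(x ^ (n + 1) + y ^ (n + 1))) * hxy
    have hpos := pow_add_pow_pos_of_mul_eq_neg_one hxy hs (n + 1)
    have hyx : y ^ (n + 1) ≤ x ^ (n + 1) :=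
      calc y ^ (n + 1) ≤ |y| ^ (n + 1) := by rw [← abs_pow]; exact le_abs_self _
        _ ≤ x ^ (n + 1) := by
          gcongr
          rw [abs_of_neg hy]
          linarith
    constructor
    · have := mul_pos hs (sub_pos.2 hlt)
      linarith
    · have h₁ : (x + y) * (x ^ (n + 2) + y ^ (n + 2) - (x + y) ^ (n + 2)) ≤
          x * (2 ^ (n + 1) * x ^ n) :=
        mul_le_mul (by linarith) hle (sub_pos.2 hlt).le (by linarith)
      have h₂ : 2 * x ^ (n + 1) ≤ 2 ^ (n + 1) * x ^ (n + 1) := by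
        gcongr
        exact le_self_pow₀ one_le_two n.succ_ne_zero
      rw [key]
      calc _ ≤ x * (2 ^ (n + 1) * x ^ n) + 2 ^ (n + 1) * x ^ (n + 1) := by linarith
        _ = 2 ^ (n + 1 + 1) * x ^ (n + 1) := by ring

theorem stmt_12 (h : ℕ) (hh : 2 ≤ h) (k : ℕ) (hk : 1 ≤ k) :
    (lucas (2 * k - 1) : ℝ) ^ h < lucas (h * (2 * k - 1)) ∧
      (lucas (h * (2 * k - 1)) : ℝ) - (lucas (2 * k - 1) : ℝ) ^ h ≤
        2 ^ (h - 1) * ((1 + Real.sqrt 5) / 2) ^ ((h - 2) * (2 * k - 1)) := by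
  obtain ⟨n, rfl⟩ := Nat.exists_eq_add_of_le' hh
  have hodd : Odd (2 * k - 1) := ⟨k - 1, by omega⟩
  have hs : (0 : ℝ) < lucas (2 * k - 1) := by exact_mod_cast lucas_pos _
  generalize 2 * k - 1 = m at *
  change _ ∧ _ ≤ 2 ^ (n + 1) * Real.goldenRatio ^ (n * m)
  rw [coe_lucas_eq] at hs
  rw [coe_lucas_eq, coe_lucas_eq, mul_comm _ m, mul_comm n m, pow_mul, pow_mul, pow_mul]
  refine add_pow_lt_and_sub_le_of_mul_eq_neg_one ?_ (one_le_pow₀ Real.one_lt_goldenRatio.le) hs n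
  rw [← mul_pow, Real.goldenRatio_mul_goldenConj, hodd.neg_one_pow]
end

section
/- For every integer k ≥ 2, the integer n_k = L_{8k} + L_{6k} + L_{4k} + L_{2k} − 1 satisfies s_F(n_k) = k + 6. -/
/-- The decreasing list `[2 * m, 2 * m - 2, …, 2]`. -/
def evensDesc : ℕ → List ℕ
  | 0 => []
  | m + 1 => 2 * (m + 1) :: evensDesc m

theorem length_evensDesc (m : ℕ) : (evensDesc m).length = m := by
  induction m with
  | zero => rfl
  | succ m ih => simp [evensDesc, ih]

theorem sum_fib_evensDesc (m : ℕ) :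
    ((evensDesc m).map Nat.fib).sum + 1 = Nat.fib (2 * m + 1) := by
  induction m with
  | zero => rfl
  | succ m ih =>
    have h : Nat.fib (2 * (m + 1) + 1) = Nat.fib (2 * m + 1) + Nat.fib (2 * (m + 1)) :=
      Nat.fib_add_two
    simp only [evensDesc, List.map_cons, List.sum_cons]
    omega

theorem isZeckendorfRep_cons_evensDesc (m a : ℕ) (ha : 2 * m + 2 ≤ a) :
    (a :: evensDesc m).IsZeckendorfRep := by
  induction m generalizing a with
  | zero => simpa [evensDesc, List.IsZeckendorfRep] using ha
  | succ m ih =>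
    have h := ih (2 * (m + 1)) le_rfl
    simp only [List.IsZeckendorfRep, evensDesc, List.cons_append] at h ⊢
    exact List.IsChain.cons_cons (by omega) h

theorem stmt_15 (k : ℕ) (hk : 2 ≤ k) :
    sF (lucas (8 * k) + lucas (6 * k) + lucas (4 * k) + lucas (2 * k) - 1) = k + 6 := by
  obtain ⟨j, rfl⟩ : ∃ j, k = j + 1 := ⟨k - 1, by omega⟩
  have hrep : ([8 * j + 9, 8 * j + 7, 6 * j + 7, 6 * j + 5, 4 * j + 5, 4 * j + 3] ++
      (2 * j + 3) :: evensDesc j).IsZeckendorfRep := by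
    have h := isZeckendorfRep_cons_evensDesc j (2 * j + 3) (by omega)
    simp only [List.IsZeckendorfRep, List.cons_append, List.nil_append,
      List.isChain_cons_cons] at h ⊢
    refine ⟨?_, ?_, ?_, ?_, ?_, ?_, h⟩ <;> omega
  have hsum : lucas (8 * (j + 1)) + lucas (6 * (j + 1)) + lucas (4 * (j + 1)) +
      lucas (2 * (j + 1)) - 1 =
      (([8 * j + 9, 8 * j + 7, 6 * j + 7, 6 * j + 5, 4 * j + 5, 4 * j + 3] ++
      (2 * j + 3) :: evensDesc j).map Nat.fib).sum := by
    have h := sum_fib_evensDesc j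
    have h8 : lucas (8 * (j + 1)) = Nat.fib (8 * j + 7) + Nat.fib (8 * j + 9) := rfl
    have h6 : lucas (6 * (j + 1)) = Nat.fib (6 * j + 5) + Nat.fib (6 * j + 7) := rfl
    have h4 : lucas (4 * (j + 1)) = Nat.fib (4 * j + 3) + Nat.fib (4 * j + 5) := rfl
    have h2 : lucas (2 * (j + 1)) = Nat.fib (2 * j + 1) + Nat.fib (2 * j + 3) := rfl
    simp only [List.cons_append, List.nil_append, List.map_cons, List.sum_cons]
    omega
  rw [hsum, sF, Nat.zeckendorf_sum_fib hrep]
  simp [length_evensDesc]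
end

section
/- For every integer k ≥ 7, the integer n_k = L_{8k} + L_{6k} + L_{4k} + L_{2k} − 1 satisfies s_F(n_k²) = 26. -/
theorem lucas_cast_eq (n : ℕ) : (lucas n : ℤ) = 2 * Nat.fib (n + 1) - Nat.fib n := by
  cases n with
  | zero => simp [lucas]
  | succ n => simp only [lucas, Nat.fib_add_two]; push_cast; ring

theorem fib_cassini_even (d : ℕ) :
    (Nat.fib (2 * d + 1) : ℤ) ^ 2 - Nat.fib (2 * d) * Nat.fib (2 * d + 1)
      - (Nat.fib (2 * d) : ℤ) ^ 2 = 1 := by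
  induction d with
  | zero => simp
  | succ d ih =>
    rw [show 2 * (d + 1) + 1 = 2 * d + 1 + 2 by ring, show 2 * (d + 1) = 2 * d + 2 by ring,
      Nat.fib_add_two (n := 2 * d + 1), Nat.fib_add_two (n := 2 * d)]
    push_cast
    linear_combination ih

theorem fib_add_cast (j m : ℕ) : (Nat.fib (j + m) : ℤ) =
    Nat.fib j * (Nat.fib (m + 1) - Nat.fib m) + Nat.fib (j + 1) * Nat.fib m := by
  cases m with
  | zero => simp
  | succ m =>
    rw [← Nat.add_assoc, Nat.fib_add, Nat.fib_add_two]
    push_cast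
    ring

theorem lucas_mul_lucas_even (n d : ℕ) :
    lucas (n + 2 * d) * lucas (2 * d) = lucas (n + 2 * d + 2 * d) + lucas n := by
  have hc := fib_cassini_even d
  zify
  simp only [lucas_cast_eq]
  rw [fib_add_cast (n + 2 * d) (2 * d), Nat.fib_add (n + 2 * d) (2 * d)]
  push_cast
  rw [fib_add_cast n (2 * d), Nat.fib_add n (2 * d)]
  push_cast
  linear_combination (2 * Nat.fib (n + 1) - Nat.fib n : ℤ) * hc

theorem lucas_eq_fib_add_fib {m : ℕ} (hm : 1 ≤ m) :
    lucas m = Nat.fib (m + 1) + Nat.fib (m - 1) := by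
  obtain ⟨p, rfl⟩ := Nat.exists_eq_add_of_le' hm
  exact Nat.add_comm _ _

theorem two_mul_lucas {m : ℕ} (hm : 3 ≤ m) :
    2 * lucas m = Nat.fib (m + 3) + Nat.fib (m - 3) := by
  obtain ⟨p, rfl⟩ := Nat.exists_eq_add_of_le' hm
  simp only [lucas, Nat.add_sub_cancel, Nat.fib_add_two]
  ring

theorem three_mul_lucas {m : ℕ} (hm : 3 ≤ m) :
    3 * lucas m = Nat.fib (m + 3) + Nat.fib (m + 1) + Nat.fib (m - 1) + Nat.fib (m - 3) := by
  have h₁ := two_mul_lucas hm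
  have h₂ := lucas_eq_fib_add_fib (m := m) (by omega)
  omega

theorem four_mul_lucas {m : ℕ} (hm : 5 ≤ m) :
    4 * lucas m = Nat.fib (m + 4) + Nat.fib (m + 1) + Nat.fib (m - 2) + Nat.fib (m - 5) := by
  obtain ⟨p, rfl⟩ := Nat.exists_eq_add_of_le' hm
  rw [show p + 5 - 2 = p + 3 by omega]
  simp only [lucas, Nat.add_sub_cancel, Nat.fib_add_two]
  ring

theorem sq_lucas_sum_sub_one (k : ℕ) :
    (lucas (8 * k) + lucas (6 * k) + lucas (4 * k) + lucas (2 * k) - 1) ^ 2 =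
      lucas (16 * k) + 2 * lucas (14 * k) + 3 * lucas (12 * k) + 4 * lucas (10 * k)
        + lucas (8 * k) + 2 * lucas (6 * k) + 3 * lucas (4 * k) + 4 * lucas (2 * k) + 9 := by
  have hprod (a b : ℕ) : lucas ((2 * a + 2 * b) * k) * lucas (2 * b * k) =
      lucas ((2 * a + 4 * b) * k) + lucas (2 * a * k) := by
    have h := lucas_mul_lucas_even (2 * a * k) (b * k)
    ring_nf at h ⊢
    exact h
  have hAA := hprod 0 4
  have hBB := hprod 0 3
  have hCC := hprod 0 2
  have hDD := hprod 0 1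
  have hAB := hprod 1 3
  have hAC := hprod 2 2
  have hAD := hprod 3 1
  have hBC := hprod 1 2
  have hBD := hprod 2 1
  have hCD := hprod 1 1
  have hpos : 1 ≤ lucas (8 * k) + lucas (6 * k) + lucas (4 * k) + lucas (2 * k) := by
    suffices 0 < lucas (2 * k) by omega
    cases 2 * k with
    | zero => simp [lucas]
    | succ m => simp [lucas]
  have h0 : lucas 0 = 2 := rfl
  norm_num [h0] at hAA hBB hCC hDD hAB hAC hAD hBC hBD hCD
  zify [hpos] at *
  linear_combination hAA + hBB + hCC + hDD
    + 2 * (hAB + hAC + hAD + hBC + hBD + hCD)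

theorem stmt_17 (k : ℕ) (hk : 7 ≤ k) :
    sF ((lucas (8 * k) + lucas (6 * k) + lucas (4 * k) + lucas (2 * k) - 1) ^ 2) = 26 := by
  let l : List ℕ := [16 * k + 1, 16 * k - 1, 14 * k + 3, 14 * k - 3,
    12 * k + 3, 12 * k + 1, 12 * k - 1, 12 * k - 3,
    10 * k + 4, 10 * k + 1, 10 * k - 2, 10 * k - 5, 8 * k + 1, 8 * k - 1, 6 * k + 3, 6 * k - 3,
    4 * k + 3, 4 * k + 1, 4 * k - 1, 4 * k - 3, 2 * k + 4, 2 * k + 1, 2 * k - 2, 2 * k - 5, 6, 2]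
  have hl : l.IsZeckendorfRep := by
    simp only [l, List.IsZeckendorfRep, List.cons_append, List.nil_append, List.isChain_cons_cons,
      List.isChain_singleton, and_true]
    and_intros <;> omega
  have hsum : (lucas (8 * k) + lucas (6 * k) + lucas (4 * k) + lucas (2 * k) - 1) ^ 2 =
      (l.map Nat.fib).sum := by
    rw [sq_lucas_sum_sub_one, lucas_eq_fib_add_fib (m := 16 * k) (by omega),
      two_mul_lucas (m := 14 * k) (by omega), three_mul_lucas (m := 12 * k) (by omega),
      four_mul_lucas (m := 10 * k) (by omega), lucas_eq_fib_add_fib (m := 8 * k) (by omega),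
      two_mul_lucas (m := 6 * k) (by omega), three_mul_lucas (m := 4 * k) (by omega),
      four_mul_lucas (m := 2 * k) (by omega)]
    have h6 : Nat.fib 6 = 8 := rfl
    have h2 : Nat.fib 2 = 1 := rfl
    simp only [l, List.map_cons, List.map_nil, List.sum_cons, List.sum_nil, h6, h2]
    ring
  rw [sF, hsum, Nat.zeckendorf_sum_fib hl]
  rfl
end
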